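/- arXiv:1609.07558 — 2 statements merged into one kernel-verified Lean document; each statement's English description precedes it below -/
import Mathlib

section
/- If m - σ²/2 < 0, the reciprocal of the limit Y₀ = lim_{τ→0} τ X∞ (in distribution) satisfies the moment identity E[Y₀^{-θ-1}] = ((θ+1)σ²/2 - m) · E[Y₀^{-θ}] for all θ in a neighborhood of 0, and the unique distribution satisfying this with moment generating function M(t) = E[e^{t/Y₀}] solving M'(t) = (σ²/2 - m)M(t) + (σ²/2) t M'(t), M(0)=1, is 1/Y₀ ~ Gamma(1 - 2m/σ², σ²/2), i.e. Y₀ follows an inverse Gamma distribution. -/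
open MeasureTheory ProbabilityTheory Real

/-- The `k`-th moment twisted by the character of frequency `t`. -/
noncomputable def twistedMoment (μ : Measure ℝ) (k : ℕ) (t : ℝ) : ℂ :=
  ∫ x, (x : ℂ) ^ k * Complex.exp (t * x * Complex.I) ∂μ

lemma norm_exp_mul_I_sub_sum_le (y : ℝ) (n : ℕ) {t : ℝ} (ht : 0 ≤ t) :
    ‖Complex.exp (t * y * Complex.I) -
      ∑ j ∈ Finset.range n, (t * y * Complex.I) ^ j / (j.factorial : ℂ)‖
        ≤ (t * |y|) ^ n / n.factorial := by
  induction n generalizing t with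
  | zero =>
    have := Complex.norm_exp_ofReal_mul_I (t * y)
    push_cast at this
    simp [this]
  | succ n ih =>
    have hderiv : ∀ x : ℝ, HasDerivAt (fun t : ℝ => Complex.exp (t * y * Complex.I) -
      ∑ j ∈ Finset.range (n + 1), (t * y * Complex.I) ^ j / (j.factorial : ℂ))
      ((Complex.exp (x * y * Complex.I) -
      ∑ j ∈ Finset.range n, (x * y * Complex.I) ^ j / (j.factorial : ℂ)) * (y * Complex.I)) x := by
      intro x
      have h1 : HasDerivAt (fun t : ℝ => (t * y * Complex.I : ℂ)) (y * Complex.I) x := by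
        have := (Complex.ofRealCLM.hasDerivAt (x := x)).mul_const (y * Complex.I : ℂ)
        simpa [mul_assoc] using this
      have h2 := h1.cexp
      have h3 : HasDerivAt (fun t : ℝ =>
          ∑ j ∈ Finset.range (n + 1), (t * y * Complex.I) ^ j / (j.factorial : ℂ))
          (∑ j ∈ Finset.range n, (x * y * Complex.I) ^ j / (j.factorial : ℂ) * (y * Complex.I))
          x := by
        simp_rw [Finset.sum_range_succ' _ n]
        simp only [pow_zero]
        refine HasDerivAt.add_const _ ?_
        refine HasDerivAt.fun_sum fun j _ => ?_
        refine ((h1.pow (j + 1)).div_const ((j + 1).factorial : ℂ)).congr_deriv ?_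
        rw [Nat.factorial_succ]
        have : (j.factorial : ℂ) ≠ 0 := by exact_mod_cast j.factorial_ne_zero
        have : ((j : ℂ) + 1) ≠ 0 := by exact_mod_cast j.succ_ne_zero
        push_cast
        field_simp
      have := h2.sub h3
      rw [← Finset.sum_mul, ← sub_mul] at this
      exact this
    have hB : ∀ x : ℝ, HasDerivAt (fun t : ℝ => (t * |y|) ^ (n + 1) / ((n + 1).factorial : ℝ))
        ((x * |y|) ^ n / n.factorial * |y|) x := by
      intro x
      have h1 : HasDerivAt (fun t : ℝ => t * |y|) |y| x := by
        simpa using (hasDerivAt_id x).mul_const |y|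
      refine ((h1.pow (n + 1)).div_const ((n + 1).factorial : ℝ)).congr_deriv ?_
      rw [Nat.factorial_succ]
      have : (n.factorial : ℝ) ≠ 0 := by exact_mod_cast n.factorial_ne_zero
      have : ((n : ℝ) + 1) ≠ 0 := by exact_mod_cast n.succ_ne_zero
      push_cast
      field_simp
    refine image_norm_le_of_norm_deriv_right_le_deriv_boundary (a := 0) (b := t)
      (fun x _ => (hderiv x).continuousAt.continuousWithinAt)
      (fun x _ => (hderiv x).hasDerivWithinAt) ?_ hB ?_ ⟨ht, le_rfl⟩
    · simp [Finset.sum_range_succ']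
    · intro x hx
      rw [norm_mul]
      have : ‖(y * Complex.I : ℂ)‖ = |y| := by simp
      rw [this]
      exact mul_le_mul_of_nonneg_right (ih hx.1) (abs_nonneg y)

lemma integrable_twisted {μ : Measure ℝ} {k : ℕ} (hk : Integrable (fun x => x ^ k) μ) (t : ℝ) :
    Integrable (fun x : ℝ => (x : ℂ) ^ k * Complex.exp (t * x * Complex.I)) μ := by
  refine hk.norm.mono' (by fun_prop) (ae_of_all _ fun x => ?_)
  have := Complex.norm_exp_ofReal_mul_I (t * x)
  push_cast at this
  simp [this]

lemma norm_twistedMoment_add_sub_le {μ : Measure ℝ} (hμ : ∀ᵐ x ∂μ, 0 < x)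
    (hint : ∀ k : ℕ, Integrable (fun x => x ^ k) μ) (k n : ℕ) (t h : ℝ) :
    ‖twistedMoment μ k (t + h) - ∑ j ∈ Finset.range n,
      (h * Complex.I) ^ j / (j.factorial : ℂ) * twistedMoment μ (k + j) t‖
      ≤ |h| ^ n / n.factorial * ∫ x, x ^ (k + n) ∂μ := by
  have h1 : ∑ j ∈ Finset.range n,
      (h * Complex.I) ^ j / (j.factorial : ℂ) * twistedMoment μ (k + j) t
      = ∫ x, ∑ j ∈ Finset.range n, (h * Complex.I) ^ j / (j.factorial : ℂ) *
        ((x : ℂ) ^ (k + j) * Complex.exp (t * x * Complex.I)) ∂μ := by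
    rw [integral_finsetSum _ fun j _ => (integrable_twisted (hint _) t).const_mul _]
    simp_rw [integral_const_mul]
    rfl
  rw [h1, twistedMoment, ← integral_sub (integrable_twisted (hint _) _)
    (integrable_finsetSum _ fun j _ => (integrable_twisted (hint _) t).const_mul _),
    ← integral_const_mul]
  refine norm_integral_le_of_norm_le ((hint _).const_mul _) ?_
  filter_upwards [hμ] with x hx
  have key : (x : ℂ) ^ k * Complex.exp ((t + h : ℝ) * x * Complex.I) -
      ∑ j ∈ Finset.range n, (h * Complex.I) ^ j / (j.factorial : ℂ) *
        ((x : ℂ) ^ (k + j) * Complex.exp (t * x * Complex.I))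
      = (x : ℂ) ^ k * Complex.exp (t * x * Complex.I) *
        (Complex.exp (x * h * Complex.I) -
          ∑ j ∈ Finset.range n, (x * h * Complex.I) ^ j / (j.factorial : ℂ)) := by
    rw [mul_sub, mul_assoc ((x : ℂ) ^ k), ← Complex.exp_add, Finset.mul_sum]
    congr 1
    · congr 2; push_cast; ring
    · refine Finset.sum_congr rfl fun j _ => ?_
      simp only [mul_pow, pow_add]; ring
  rw [key, norm_mul, norm_mul]
  have h2 := Complex.norm_exp_ofReal_mul_I (t * x)
  push_cast at h2
  rw [h2, mul_one, norm_pow, Complex.norm_real, Real.norm_of_nonneg hx.le]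
  calc x ^ k * _ ≤ x ^ k * ((x * |h|) ^ n / n.factorial) :=
        mul_le_mul_of_nonneg_left (norm_exp_mul_I_sub_sum_le h n hx.le) (by positivity)
    _ = _ := by rw [mul_pow, pow_add]; ring

lemma tendsto_twistedMoment_add {ι : Type*} {l : Filter ι} {μ : ι → Measure ℝ} {γ : Measure ℝ}
    (hμ : ∀ i, ∀ᵐ x ∂μ i, 0 < x) (hint : ∀ i, ∀ k : ℕ, Integrable (fun x => x ^ k) (μ i))
    (hγ : ∀ᵐ x ∂γ, 0 < x) (hγint : ∀ k : ℕ, Integrable (fun x => x ^ k) γ)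
    (hmom : ∀ k : ℕ, Filter.Tendsto (fun i => ∫ x, x ^ k ∂μ i) l (nhds (∫ x, x ^ k ∂γ)))
    {h : ℝ} (hgrow : ∀ k : ℕ, Filter.Tendsto
      (fun n : ℕ => |h| ^ n / n.factorial * ∫ x, x ^ (k + n) ∂γ) Filter.atTop (nhds 0))
    {t : ℝ} (ht : ∀ k, Filter.Tendsto (fun i => twistedMoment (μ i) k t) l
      (nhds (twistedMoment γ k t))) (k : ℕ) :
    Filter.Tendsto (fun i => twistedMoment (μ i) k (t + h)) l
      (nhds (twistedMoment γ k (t + h))) := by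
  rw [Metric.tendsto_nhds]
  intro ε hε
  obtain ⟨n, hn⟩ := ((hgrow k).eventually (gt_mem_nhds (show (0 : ℝ) < ε / 3 by linarith))).exists
  set S : Measure ℝ → ℂ := fun ρ => ∑ j ∈ Finset.range n,
      (h * Complex.I) ^ j / (j.factorial : ℂ) * twistedMoment ρ (k + j) t
  have hS : Filter.Tendsto (fun i => S (μ i)) l (nhds (S γ)) :=
    tendsto_finsetSum _ fun j _ => (ht _).const_mul _
  filter_upwards [(Metric.tendsto_nhds.1 hS) (ε / 3) (by linarith),
    ((hmom (k + n)).const_mul (|h| ^ n / n.factorial)).eventually (gt_mem_nhds hn)] with i h1 h2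
  have h3 := norm_twistedMoment_add_sub_le (hμ i) (hint i) k n t h
  have h4 := norm_twistedMoment_add_sub_le hγ hγint k n t h
  rw [dist_eq_norm] at h1 ⊢
  have : twistedMoment (μ i) k (t + h) - twistedMoment γ k (t + h) =
      (twistedMoment (μ i) k (t + h) - S (μ i)) + (S (μ i) - S γ)
        - (twistedMoment γ k (t + h) - S γ) := by ring
  rw [this]
  refine (norm_sub_le _ _).trans_lt ?_
  have h5 := norm_add_le (twistedMoment (μ i) k (t + h) - S (μ i)) (S (μ i) - S γ)
  linarith

/-- Method of moments for laws on the positive half-line whose limit has geometrically bounded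
normalised moments. -/
lemma tendsto_twistedMoment {ι : Type*} {l : Filter ι} {μ : ι → Measure ℝ} {γ : Measure ℝ}
    (hμ : ∀ i, ∀ᵐ x ∂μ i, 0 < x) (hint : ∀ i, ∀ k : ℕ, Integrable (fun x => x ^ k) (μ i))
    (hγ : ∀ᵐ x ∂γ, 0 < x) (hγint : ∀ k : ℕ, Integrable (fun x => x ^ k) γ)
    (hmom : ∀ k : ℕ, Filter.Tendsto (fun i => ∫ x, x ^ k ∂μ i) l (nhds (∫ x, x ^ k ∂γ)))
    {R : ℝ} (hR : 0 < R) (hgrow : ∀ h : ℝ, |h| ≤ R → ∀ k : ℕ, Filter.Tendsto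
      (fun n : ℕ => |h| ^ n / n.factorial * ∫ x, x ^ (k + n) ∂γ) Filter.atTop (nhds 0))
    (t : ℝ) (k : ℕ) :
    Filter.Tendsto (fun i => twistedMoment (μ i) k t) l (nhds (twistedMoment γ k t)) := by
  obtain ⟨N, hN⟩ := exists_nat_gt (|t| / R)
  have hN0 : (0 : ℝ) < N := lt_of_le_of_lt (by positivity) hN
  have hh : |t / N| ≤ R := by
    rw [abs_div, Nat.abs_cast, div_le_iff₀ hN0]
    rw [div_lt_iff₀ hR] at hN
    linarith
  have main : ∀ j : ℕ, ∀ k, Filter.Tendsto (fun i => twistedMoment (μ i) k (j * (t / N))) l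
      (nhds (twistedMoment γ k (j * (t / N)))) := by
    intro j
    induction j with
    | zero =>
      intro k
      have h0 : ∀ ρ : Measure ℝ, twistedMoment ρ k 0 = ((∫ x, x ^ k ∂ρ : ℝ) : ℂ) := by
        intro ρ
        rw [twistedMoment, ← integral_complex_ofReal]
        simp
      simp only [Nat.cast_zero, zero_mul, h0]
      exact (Complex.continuous_ofReal.tendsto _).comp (hmom k)
    | succ j ih =>
      intro k
      have := tendsto_twistedMoment_add hμ hint hγ hγint hmom (hgrow _ hh) ih k
      have e : ((j + 1 : ℕ) : ℝ) * (t / N) = j * (t / N) + t / N := by push_cast; ring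
      rwa [e]
  have := main N k
  rwa [mul_div_cancel₀ _ hN0.ne'] at this

lemma tendsto_integral_of_moments {μ : ℕ → Measure ℝ} {γ : Measure ℝ}
    [hp : ∀ i, IsProbabilityMeasure (μ i)] [hpγ : IsProbabilityMeasure γ]
    (hμ : ∀ i, ∀ᵐ x ∂μ i, 0 < x) (hint : ∀ i, ∀ k : ℕ, Integrable (fun x => x ^ k) (μ i))
    (hγ : ∀ᵐ x ∂γ, 0 < x) (hγint : ∀ k : ℕ, Integrable (fun x => x ^ k) γ)
    (hmom : ∀ k : ℕ, Filter.Tendsto (fun i => ∫ x, x ^ k ∂μ i) Filter.atTop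
      (nhds (∫ x, x ^ k ∂γ)))
    {R : ℝ} (hR : 0 < R) (hgrow : ∀ h : ℝ, |h| ≤ R → ∀ k : ℕ, Filter.Tendsto
      (fun n : ℕ => |h| ^ n / n.factorial * ∫ x, x ^ (k + n) ∂γ) Filter.atTop (nhds 0))
    (f : BoundedContinuousFunction ℝ ℝ) :
    Filter.Tendsto (fun i => ∫ x, f x ∂μ i) Filter.atTop (nhds (∫ x, f x ∂γ)) := by
  let ρ : ℕ → ProbabilityMeasure ℝ := fun i => ⟨μ i, hp i⟩
  let ρ₀ : ProbabilityMeasure ℝ := ⟨γ, hpγ⟩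
  have hlim : Filter.Tendsto ρ Filter.atTop (nhds ρ₀) := by
    rw [ProbabilityMeasure.tendsto_iff_tendsto_charFun]
    intro t
    have h0 : ∀ ρ : Measure ℝ, charFun ρ t = twistedMoment ρ 0 t := by
      intro ρ
      rw [charFun_apply_real, twistedMoment]
      simp
    simp only [h0]
    exact tendsto_twistedMoment hμ hint hγ hγint hmom hR hgrow t 0
  exact (ProbabilityMeasure.tendsto_iff_forall_integral_tendsto.1 hlim) f

lemma ae_pos_gammaMeasure (a r : ℝ) : ∀ᵐ x ∂gammaMeasure a r, 0 < x := by
  rw [ae_iff, gammaMeasure]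
  have : {x : ℝ | ¬ 0 < x} = Set.Iic 0 := by ext; simp
  rw [this, withDensity_apply _ measurableSet_Iic, setLIntegral_congr Iio_ae_eq_Iic.symm]
  exact lintegral_gammaPDF_of_nonpos le_rfl

lemma gammaMeasure_moment {a r : ℝ} (ha : 0 < a) (hr : 0 < r) {θ : ℝ} (hθ : 0 < a + θ) :
    Integrable (fun x => x ^ θ) (gammaMeasure a r) ∧
    ∫ x, x ^ θ ∂(gammaMeasure a r) =
      r ^ a / Gamma a * ((1 / r) ^ (a + θ) * Gamma (a + θ)) := by
  have hpdf : Measurable (gammaPDF a r) := (measurable_gammaPDFReal a r).ennreal_ofReal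
  have htop : ∀ᵐ x, gammaPDF a r x < ⊤ := ae_of_all _ fun x => ENNReal.ofReal_lt_top
  have hval : ∀ x, (gammaPDF a r x).toReal • x ^ θ = Set.indicator (Set.Ici 0)
      (fun x => r ^ a / Gamma a * (x ^ (a - 1) * x ^ θ * exp (-(r * x)))) x := by
    intro x
    rw [gammaPDF, ENNReal.toReal_ofReal (gammaPDFReal_nonneg ha hr x), gammaPDFReal,
      Set.indicator_apply]
    simp only [Set.mem_Ici, smul_eq_mul]
    split_ifs
    · ring
    · simp
  have hcongr : Set.EqOn
      (fun x : ℝ => r ^ a / Gamma a * (x ^ (a + θ - 1) * exp (-(r * x))))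
      (fun x => r ^ a / Gamma a * (x ^ (a - 1) * x ^ θ * exp (-(r * x)))) (Set.Ioi 0) := by
    intro x hx
    simp only
    rw [← Real.rpow_add hx]
    ring_nf
  have hint : IntegrableOn (fun x : ℝ => x ^ (a + θ - 1) * exp (-(r * x))) (Set.Ioi 0) := by
    have := integrableOn_rpow_mul_exp_neg_mul_rpow (s := a + θ - 1) (p := 1) (b := r)
      (by linarith) one_pos hr
    simpa using this
  constructor
  · rw [gammaMeasure, integrable_withDensity_iff_integrable_smul' hpdf htop]
    simp_rw [hval]
    rw [integrable_indicator_iff measurableSet_Ici, integrableOn_Ici_iff_integrableOn_Ioi]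
    exact IntegrableOn.congr_fun (hint.const_mul _) hcongr measurableSet_Ioi
  · rw [gammaMeasure, integral_withDensity_eq_integral_toReal_smul hpdf htop]
    simp_rw [hval]
    rw [integral_indicator measurableSet_Ici, integral_Ici_eq_integral_Ioi,
      ← setIntegral_congr_fun measurableSet_Ioi hcongr, integral_const_mul,
      integral_rpow_mul_exp_neg_mul_Ioi hθ hr]

lemma gammaMeasure_moment_succ {a r : ℝ} (ha : 0 < a) (hr : 0 < r) {θ : ℝ} (hθ : 0 < a + θ) :
    ∫ x, x ^ (θ + 1) ∂(gammaMeasure a r) =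
      (a + θ) / r * ∫ x, x ^ θ ∂(gammaMeasure a r) := by
  rw [(gammaMeasure_moment ha hr hθ).2,
    (gammaMeasure_moment ha hr (θ := θ + 1) (by linarith)).2, ← add_assoc,
    Real.Gamma_add_one hθ.ne', Real.rpow_add_one (by positivity)]
  field_simp

lemma integrable_pow_gammaMeasure {a r : ℝ} (ha : 0 < a) (hr : 0 < r) (k : ℕ) :
    Integrable (fun x => x ^ k) (gammaMeasure a r) := by
  have := (gammaMeasure_moment ha hr (θ := k) (by positivity)).1
  simpa using this

lemma integral_pow_succ_gammaMeasure {a r : ℝ} (ha : 0 < a) (hr : 0 < r) (k : ℕ) :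
    ∫ x, x ^ (k + 1) ∂(gammaMeasure a r) = (a + k) / r * ∫ x, x ^ k ∂(gammaMeasure a r) := by
  have := gammaMeasure_moment_succ ha hr (θ := k) (by positivity)
  exact_mod_cast this

lemma integral_pow_gammaMeasure_pos {a r : ℝ} (ha : 0 < a) (hr : 0 < r) (k : ℕ) :
    0 < ∫ x, x ^ k ∂(gammaMeasure a r) := by
  have := isProbabilityMeasure_gammaMeasure ha hr
  induction k with
  | zero => simp
  | succ k ih => rw [integral_pow_succ_gammaMeasure ha hr]; positivity

lemma tendsto_pow_div_factorial_mul_moment {a r : ℝ} (ha : 0 < a) (hr : 0 < r) {h : ℝ}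
    (hh : |h| ≤ r / 2) (k : ℕ) : Filter.Tendsto
      (fun n : ℕ => |h| ^ n / n.factorial * ∫ x, x ^ (k + n) ∂(gammaMeasure a r))
      Filter.atTop (nhds 0) := by
  have hpos := integral_pow_gammaMeasure_pos ha hr
  have hs : Summable (fun n : ℕ =>
      (r / 2) ^ n / n.factorial * ∫ x, x ^ (k + n) ∂(gammaMeasure a r)) := by
    refine summable_of_ratio_test_tendsto_lt_one (l := 1 / 2) (by norm_num)
      (Filter.Eventually.of_forall fun n => ?_) ?_
    · have := hpos (k + n)
      positivity
    · have hratio : ∀ n : ℕ,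
          ‖(r / 2) ^ (n + 1) / ((n + 1).factorial : ℝ) *
              ∫ x, x ^ (k + (n + 1)) ∂(gammaMeasure a r)‖ /
            ‖(r / 2) ^ n / (n.factorial : ℝ) * ∫ x, x ^ (k + n) ∂(gammaMeasure a r)‖
          = 1 / 2 + (a + k - 1) / 2 * (1 / ((n : ℝ) + 1)) := by
        intro n
        have h1 := hpos (k + n)
        have h2 := hpos (k + (n + 1))
        rw [Real.norm_of_nonneg (by positivity), Real.norm_of_nonneg (by positivity),
          ← add_assoc, integral_pow_succ_gammaMeasure ha hr, Nat.factorial_succ]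
        have : (n.factorial : ℝ) ≠ 0 := by exact_mod_cast n.factorial_ne_zero
        push_cast
        field_simp
        ring
      simp_rw [hratio]
      have := ((tendsto_one_div_add_atTop_nhds_zero_nat (𝕜 := ℝ)).const_mul
        ((a + k - 1) / 2)).const_add (1 / 2)
      rwa [mul_zero, add_zero] at this
  refine squeeze_zero (fun n => ?_) (fun n => ?_) hs.tendsto_atTop_zero
  · have := hpos (k + n)
    positivity
  · have := hpos (k + n)
    gcongr

lemma integral_exp_gaussianReal (s d : ℝ) (p : ℕ) :
    Integrable (fun z => exp (d - s * z) ^ p) (gaussianReal 0 1) ∧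
    ∫ z, exp (d - s * z) ^ p ∂(gaussianReal 0 1) = exp (p * d + p ^ 2 * s ^ 2 / 2) := by
  have h : ∀ z, exp (d - s * z) ^ p = exp (p * d) * exp ((-(p * s)) * z) := by
    intro z
    rw [← Real.exp_nat_mul, ← Real.exp_add]
    ring_nf
  simp_rw [h]
  refine ⟨(integrable_exp_mul_gaussianReal _).const_mul _, ?_⟩
  rw [integral_const_mul]
  have := congrFun (mgf_id_gaussianReal (μ := 0) (v := 1)) (-(p * s))
  simp only [mgf, id] at this
  rw [this, ← Real.exp_add]
  congr 1
  push_cast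
  ring

/-- A law on the positive half-line which is invariant under `w ↦ exp (d - s Z) * w / (1 + τ w)`
with `Z` standard normal and independent of `w`. -/
structure IsInvariantLaw (s d τ : ℝ) (μ : Measure ℝ) : Prop where
  prob : IsProbabilityMeasure μ
  pos : ∀ᵐ x ∂μ, 0 < x
  map_eq : Measure.map (fun p : ℝ × ℝ => exp (d - s * p.1) * (p.2 / (1 + τ * p.2)))
    ((gaussianReal 0 1).prod μ) = μ

namespace IsInvariantLaw

variable {s d τ : ℝ} {μ : Measure ℝ}

lemma integrable_div_pow (h : IsInvariantLaw s d τ μ) (hτ : 0 < τ) (p : ℕ) :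
    Integrable (fun x => (x / (1 + τ * x)) ^ p) μ := by
  have := h.prob
  refine Integrable.of_bound (Measurable.aestronglyMeasurable (by fun_prop)) ((1 / τ) ^ p) ?_
  filter_upwards [h.pos] with x hx
  rw [Real.norm_of_nonneg (by positivity)]
  refine pow_le_pow_left₀ (by positivity) ?_ p
  rw [div_le_div_iff₀ (by positivity) hτ]
  linarith

lemma integrable_pow (h : IsInvariantLaw s d τ μ) (hτ : 0 < τ) (p : ℕ) :
    Integrable (fun x => x ^ p) μ := by
  have := h.prob
  rw [← h.map_eq, integrable_map_measure (by fun_prop) (by fun_prop)]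
  simp only [Function.comp_def, mul_pow]
  exact (integral_exp_gaussianReal s d p).1.mul_prod (h.integrable_div_pow hτ p)

lemma integral_pow (h : IsInvariantLaw s d τ μ) (p : ℕ) :
    ∫ x, x ^ p ∂μ =
      exp (p * d + p ^ 2 * s ^ 2 / 2) * ∫ x, (x / (1 + τ * x)) ^ p ∂μ := by
  have := h.prob
  conv_lhs => rw [← h.map_eq]
  rw [integral_map (by fun_prop) (by fun_prop)]
  simp only [mul_pow]
  rw [integral_prod_mul (fun z => exp (d - s * z) ^ p) (fun x => (x / (1 + τ * x)) ^ p),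
    (integral_exp_gaussianReal s d p).2]

/-- Balance of the `p`-th moments, from above. -/
lemma integral_pow_succ_le (h : IsInvariantLaw s d τ μ) (hτ : 0 < τ) (p : ℕ) :
    p * τ * ∫ x, x ^ (p + 1) ∂μ ≤
      exp ((p + 1) * d + (p + 1) ^ 2 * s ^ 2 / 2) * (p * d + p ^ 2 * s ^ 2 / 2)
        * ∫ x, x ^ p ∂μ := by
  have := h.prob
  have hmono : p * τ * ∫ x, (x / (1 + τ * x)) ^ (p + 1) ∂μ ≤
      ∫ x, x ^ p - (x / (1 + τ * x)) ^ p ∂μ := by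
    rw [← integral_const_mul]
    refine integral_mono_ae ((h.integrable_div_pow hτ _).const_mul _)
      ((h.integrable_pow hτ p).sub (h.integrable_div_pow hτ p)) ?_
    filter_upwards [h.pos] with x hx
    have h1 : 0 < 1 + τ * x := by positivity
    set u := x / (1 + τ * x) with hu
    have hu0 : 0 < u := by positivity
    have hxu : x = u * (1 + τ * x) := by rw [hu]; field_simp
    have hux : u ≤ x := by
      rw [hu, div_le_iff₀ h1]
      nlinarith [mul_pos (mul_pos hτ hx) hx]
    have h2 : 1 + (p : ℝ) * (τ * x) ≤ (1 + τ * x) ^ p :=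
      one_add_mul_le_pow (by nlinarith [mul_pos hτ hx]) p
    have h3 : x ^ p = u ^ p * (1 + τ * x) ^ p := by rw [← mul_pow, ← hxu]
    have h4 : u ^ p * (1 + (p : ℝ) * (τ * x)) ≤ x ^ p := by
      rw [h3]; exact mul_le_mul_of_nonneg_left h2 (by positivity)
    have h5 : (p : ℝ) * τ * u ^ p * u ≤ (p : ℝ) * τ * u ^ p * x :=
      mul_le_mul_of_nonneg_left hux (by positivity)
    rw [pow_succ]
    linarith
  rw [integral_sub (h.integrable_pow hτ p) (h.integrable_div_pow hτ p)] at hmono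
  have hp := h.integral_pow p
  have hp1 := h.integral_pow (p + 1)
  push_cast at hp1
  set E := (p : ℝ) * d + p ^ 2 * s ^ 2 / 2
  have hJ : 0 ≤ ∫ x, x ^ p ∂μ := by
    refine integral_nonneg_of_ae ?_
    filter_upwards [h.pos] with x hx
    exact pow_nonneg hx.le _
  have hU : ∫ x, (x / (1 + τ * x)) ^ p ∂μ = exp (-E) * ∫ x, x ^ p ∂μ := by
    rw [hp, ← mul_assoc, ← Real.exp_add]; simp
  rw [hU] at hmono
  have h6 : (1 - exp (-E)) * ∫ x, x ^ p ∂μ ≤ E * ∫ x, x ^ p ∂μ :=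
    mul_le_mul_of_nonneg_right (by linarith [Real.add_one_le_exp (-E)]) hJ
  rw [hp1]
  calc _ = exp ((p + 1) * d + (p + 1) ^ 2 * s ^ 2 / 2) *
        (p * τ * ∫ x, (x / (1 + τ * x)) ^ (p + 1) ∂μ) := by ring
    _ ≤ exp ((p + 1) * d + (p + 1) ^ 2 * s ^ 2 / 2) * (E * ∫ x, x ^ p ∂μ) := by
      refine mul_le_mul_of_nonneg_left ?_ (Real.exp_pos _).le
      linarith
    _ = _ := by ring

/-- Balance of the `p`-th moments, from below. -/
lemma le_integral_pow_succ (h : IsInvariantLaw s d τ μ) (hτ : 0 < τ) (p : ℕ) :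
    exp (-(p * d + p ^ 2 * s ^ 2 / 2)) * (p * d + p ^ 2 * s ^ 2 / 2) * ∫ x, x ^ p ∂μ ≤
      p * τ * ∫ x, x ^ (p + 1) ∂μ := by
  have := h.prob
  have hmono : ∫ x, x ^ p - (x / (1 + τ * x)) ^ p ∂μ ≤ p * τ * ∫ x, x ^ (p + 1) ∂μ := by
    rw [← integral_const_mul]
    refine integral_mono_ae ((h.integrable_pow hτ p).sub (h.integrable_div_pow hτ p))
      ((h.integrable_pow hτ _).const_mul _) ?_
    filter_upwards [h.pos] with x hx
    have h1 : 0 < 1 + τ * x := by positivity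
    set u := x / (1 + τ * x) with hu
    have hu0 : 0 < u := by positivity
    have hux : u ≤ x := by
      rw [hu, div_le_iff₀ h1]
      nlinarith [mul_pos (mul_pos hτ hx) hx]
    have hu1 : τ * u ≤ 1 := by
      rw [hu, ← mul_div_assoc, div_le_one h1]; linarith
    have huu : u = x * (1 + -(τ * u)) := by rw [hu]; field_simp; ring
    have h2 : 1 + (p : ℝ) * (-(τ * u)) ≤ (1 + -(τ * u)) ^ p :=
      one_add_mul_le_pow (by linarith) p
    have h3 : u ^ p = x ^ p * (1 + -(τ * u)) ^ p := by rw [← mul_pow, ← huu]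
    have h4 : x ^ p * (1 + (p : ℝ) * (-(τ * u))) ≤ u ^ p := by
      rw [h3]; exact mul_le_mul_of_nonneg_left h2 (by positivity)
    have h5 : (p : ℝ) * τ * x ^ p * u ≤ (p : ℝ) * τ * x ^ p * x :=
      mul_le_mul_of_nonneg_left hux (by positivity)
    rw [pow_succ]
    linarith
  rw [integral_sub (h.integrable_pow hτ p) (h.integrable_div_pow hτ p)] at hmono
  have hp := h.integral_pow p
  set E := (p : ℝ) * d + p ^ 2 * s ^ 2 / 2
  have hJ : 0 ≤ ∫ x, x ^ p ∂μ := by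
    refine integral_nonneg_of_ae ?_
    filter_upwards [h.pos] with x hx
    exact pow_nonneg hx.le _
  have hU : ∫ x, (x / (1 + τ * x)) ^ p ∂μ = exp (-E) * ∫ x, x ^ p ∂μ := by
    rw [hp, ← mul_assoc, ← Real.exp_add]; simp
  rw [hU] at hmono
  have h6 : exp (-E) * E ≤ 1 - exp (-E) := by
    have h7 := mul_le_mul_of_nonneg_left (Real.add_one_le_exp E) (Real.exp_pos (-E)).le
    rw [← Real.exp_add] at h7
    simp only [neg_add_cancel, Real.exp_zero] at h7
    linarith
  have := mul_le_mul_of_nonneg_right h6 hJ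
  linarith

end IsInvariantLaw

/-- Truncation of a real number to `[-n, n]`. -/
noncomputable def clip (n : ℕ) (y : ℝ) : ℝ := max (-n) (min n y)

lemma measurable_clip (n : ℕ) : Measurable (clip n) := by unfold clip; fun_prop

lemma abs_clip_sub_le (n : ℕ) (x y : ℝ) : |clip n x - clip n y| ≤ |x - y| := by
  unfold clip
  refine (abs_max_sub_max_le_max _ _ _ _).trans ?_
  simp only [sub_self, abs_zero]
  refine max_le (abs_nonneg _) ((abs_min_sub_min_le_max _ _ _ _).trans ?_)
  simp

lemma abs_clip_le (n : ℕ) (x : ℝ) : |clip n x| ≤ n := by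
  rw [abs_le, clip]
  have : (0 : ℝ) ≤ n := n.cast_nonneg
  exact ⟨le_max_left _ _, max_le (by linarith) (min_le_left _ _)⟩

lemma tendsto_clip (x : ℝ) : Filter.Tendsto (fun n => clip n x) Filter.atTop (nhds x) := by
  obtain ⟨N, hN⟩ := exists_nat_ge |x|
  refine tendsto_const_nhds.congr' ?_
  filter_upwards [Filter.eventually_ge_atTop N] with n hn
  have h1 : |x| ≤ n := hN.trans (by exact_mod_cast hn)
  rw [abs_le] at h1
  rw [clip, min_eq_right h1.2, max_eq_right h1.1]

/-- Integrable increments integrate to the limit of the truncated increments, even if the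
random variable being incremented is not integrable. -/
lemma tendsto_integral_clip_add_sub {Ω : Type*} [MeasurableSpace Ω] {P : Measure Ω}
    {Y H : Ω → ℝ} (hY : AEMeasurable Y P) (hH : Integrable H P) :
    Filter.Tendsto (fun n => ∫ ω, clip n (Y ω + H ω) - clip n (Y ω) ∂P) Filter.atTop
      (nhds (∫ ω, H ω ∂P)) := by
  refine tendsto_integral_of_dominated_convergence (fun ω => |H ω|) (fun n => ?_) hH.abs
    (fun n => ae_of_all _ fun ω => ?_) (ae_of_all _ fun ω => ?_)
  · exact (((measurable_clip n).comp_aemeasurable (hY.add hH.aemeasurable)).sub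
      ((measurable_clip n).comp_aemeasurable hY)).aestronglyMeasurable
  · simpa using abs_clip_sub_le n (Y ω + H ω) (Y ω)
  · simpa using (tendsto_clip (Y ω + H ω)).sub (tendsto_clip (Y ω))

namespace IsInvariantLaw

variable {s d τ : ℝ} {μ : Measure ℝ}

lemma integrable_log (h : IsInvariantLaw s d τ μ) (hτ : 0 < τ) :
    Integrable (fun x => log (1 + τ * x)) μ := by
  have h1 := (h.integrable_pow hτ 1).const_mul τ
  refine h1.mono' (Measurable.aestronglyMeasurable (by fun_prop)) ?_
  filter_upwards [h.pos] with x hx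
  have : 0 < τ * x := by positivity
  rw [Real.norm_of_nonneg (Real.log_nonneg (by linarith)), pow_one]
  linarith [Real.log_le_sub_one_of_pos (show 0 < 1 + τ * x by linarith)]

/-- Balance of the logarithms. -/
lemma integral_log (h : IsInvariantLaw s d τ μ) (hτ : 0 < τ) :
    ∫ x, log (1 + τ * x) ∂μ = d := by
  have := h.prob
  set γ : Measure ℝ := gaussianReal 0 1
  have hid : Integrable (fun z : ℝ => z) γ := IsGaussian.integrable_id
  have hG : Integrable (fun z : ℝ => d - s * z) γ := (integrable_const d).sub (hid.const_mul s)
  have hGint : ∫ z, d - s * z ∂γ = d := by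
    rw [integral_sub (integrable_const d) (hid.const_mul s), integral_const_mul,
      integral_id_gaussianReal]
    simp
  set Y : ℝ → ℝ := fun x => log (x / (1 + τ * x)) with hYdef
  have hY : Measurable Y := by fun_prop
  have hclip : ∀ (n : ℕ) {Ω : Type} [MeasurableSpace Ω] (P : Measure Ω) [IsProbabilityMeasure P]
      (f : Ω → ℝ), Measurable f → Integrable (fun ω => clip n (f ω)) P := fun n _ _ P _ f hf =>
    Integrable.of_bound ((measurable_clip n).comp hf).aestronglyMeasurable n
      (ae_of_all _ fun ω => abs_clip_le n _)
  have h1 := tendsto_integral_clip_add_sub (P := μ) hY.aemeasurable (h.integrable_log hτ)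
  have h2 := tendsto_integral_clip_add_sub (P := γ.prod μ) (Y := fun p => Y p.2)
    (H := fun p => d - s * p.1) (by fun_prop) (hG.comp_fst μ)
  have h3 : ∫ p, d - s * p.1 ∂(γ.prod μ) = d := by
    rw [integral_fun_fst (f := fun z => d - s * z), hGint]; simp
  rw [h3] at h2
  refine tendsto_nhds_unique h1 (h2.congr fun n => ?_)
  rw [integral_sub (hclip n _ _ (by fun_prop)) (hclip n _ _ (by fun_prop)),
    integral_sub (hclip n _ _ (by fun_prop)) (hclip n _ _ (by fun_prop)),
    integral_fun_snd (f := fun x => clip n (Y x))]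
  simp only [probReal_univ, one_smul]
  congr 1
  have h4 : ∫ x, clip n (Y x + log (1 + τ * x)) ∂μ = ∫ x, clip n (log x) ∂μ := by
    refine integral_congr_ae ?_
    filter_upwards [h.pos] with x hx
    have : 0 < 1 + τ * x := by positivity
    rw [hYdef]
    simp only
    rw [Real.log_div hx.ne' this.ne']
    ring_nf
  have h5 : ∫ x, clip n (log x) ∂μ = ∫ p, clip n (log
      (exp (d - s * p.1) * (p.2 / (1 + τ * p.2)))) ∂(γ.prod μ) := by
    conv_lhs => rw [← h.map_eq]
    exact integral_map (by fun_prop)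
      ((measurable_clip n).comp Real.measurable_log).aestronglyMeasurable
  rw [h4, h5]
  refine integral_congr_ae ?_
  have hpos : ∀ᵐ p ∂(γ.prod μ), 0 < p.2 := Measure.quasiMeasurePreserving_snd.ae h.pos
  filter_upwards [hpos] with p hp
  have : 0 < p.2 / (1 + τ * p.2) := by positivity
  rw [Real.log_mul (Real.exp_pos _).ne' this.ne', Real.log_exp, add_comm]

lemma le_integral_id (h : IsInvariantLaw s d τ μ) (hτ : 0 < τ) :
    d ≤ τ * ∫ x, x ^ 1 ∂μ := by
  rw [← h.integral_log hτ, ← integral_const_mul]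
  refine integral_mono_ae (h.integrable_log hτ) ((h.integrable_pow hτ 1).const_mul τ) ?_
  filter_upwards [h.pos] with x hx
  rw [pow_one]
  linarith [Real.log_le_sub_one_of_pos (show 0 < 1 + τ * x by positivity)]

lemma integral_id_le (h : IsInvariantLaw s d τ μ) (hτ : 0 < τ) :
    τ * ∫ x, x ^ 1 ∂μ ≤ exp (d + s ^ 2 / 2) * d := by
  have h1 : τ * ∫ x, (x / (1 + τ * x)) ^ 1 ∂μ ≤ d := by
    conv_rhs => rw [← h.integral_log hτ]
    rw [← integral_const_mul]
    refine integral_mono_ae ((h.integrable_div_pow hτ 1).const_mul τ) (h.integrable_log hτ) ?_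
    filter_upwards [h.pos] with x hx
    have hp : 0 < 1 + τ * x := by positivity
    have := Real.one_sub_inv_le_log_of_pos hp
    have e : 1 - (1 + τ * x)⁻¹ = τ * (x / (1 + τ * x)) ^ 1 := by field_simp; ring
    linarith
  have h2 := h.integral_pow 1
  simp only [Nat.cast_one, one_mul, one_pow] at h2
  rw [h2]
  calc _ = exp (d + s ^ 2 / 2) * (τ * ∫ x, (x / (1 + τ * x)) ^ 1 ∂μ) := by ring
    _ ≤ _ := mul_le_mul_of_nonneg_left h1 (Real.exp_pos _).le

end IsInvariantLaw

namespace IsInvariantLaw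

variable {σ c τ : ℝ} {μ : Measure ℝ}

lemma integral_pow_succ_mem_Icc (h : IsInvariantLaw (σ * √τ) (c * τ) τ μ) (hτ : 0 < τ) (k : ℕ) :
    exp (-((k * c + k ^ 2 * σ ^ 2 / 2) * τ)) * (c + k * σ ^ 2 / 2) * ∫ x, x ^ k ∂μ
      ≤ ∫ x, x ^ (k + 1) ∂μ ∧
    ∫ x, x ^ (k + 1) ∂μ ≤
      exp (((k + 1) * c + (k + 1) ^ 2 * σ ^ 2 / 2) * τ) * (c + k * σ ^ 2 / 2)
        * ∫ x, x ^ k ∂μ := by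
  have := h.prob
  have hs : (σ * √τ) ^ 2 = σ ^ 2 * τ := by rw [mul_pow, Real.sq_sqrt hτ.le]
  rcases Nat.eq_zero_or_pos k with rfl | hk
  · have h1 := h.le_integral_id hτ
    have h2 := h.integral_id_le hτ
    rw [hs] at h2
    simp only [Nat.cast_zero, zero_mul, zero_add, pow_zero, integral_const, probReal_univ,
      one_smul, mul_one, ne_eq, OfNat.ofNat_ne_zero, not_false_eq_true, zero_pow, zero_div,
      add_zero, neg_zero, Real.exp_zero, one_mul, one_pow] at *
    constructor
    · nlinarith
    · have e : (c + σ ^ 2 / 2) * τ = c * τ + σ ^ 2 * τ / 2 := by ring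
      rw [e]
      nlinarith
  · have hk' : (0 : ℝ) < k := by exact_mod_cast hk
    have h1 := h.le_integral_pow_succ hτ k
    have h2 := h.integral_pow_succ_le hτ k
    rw [hs] at h1 h2
    have hkτ : 0 < k * τ := by positivity
    have e1 : k * (c * τ) + k ^ 2 * (σ ^ 2 * τ) / 2 = (k * c + k ^ 2 * σ ^ 2 / 2) * τ := by ring
    have e2 : (k + 1) * (c * τ) + (k + 1) ^ 2 * (σ ^ 2 * τ) / 2 =
      ((k + 1) * c + (k + 1) ^ 2 * σ ^ 2 / 2) * τ := by ring
    rw [e1] at h1 h2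
    rw [e2] at h2
    constructor
    · refine le_of_mul_le_mul_left ?_ hkτ
      linarith
    · refine le_of_mul_le_mul_left ?_ hkτ
      linarith

end IsInvariantLaw

lemma tendsto_moment_of_isInvariantLaw {σ c a r : ℝ} (ha : 0 < a) (hr : 0 < r)
    (hrec : ∀ k : ℕ, (a + k) / r = c + k * σ ^ 2 / 2)
    {τ : ℕ → ℝ} (hτ : ∀ n, 0 < τ n) (hlim : Filter.Tendsto τ Filter.atTop (nhds 0))
    {μ : ℕ → Measure ℝ} (hμ : ∀ n, IsInvariantLaw (σ * √(τ n)) (c * τ n) (τ n) (μ n)) (k : ℕ) :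
    Filter.Tendsto (fun n => ∫ x, x ^ k ∂μ n) Filter.atTop
      (nhds (∫ x, x ^ k ∂gammaMeasure a r)) := by
  induction k with
  | zero =>
    have := isProbabilityMeasure_gammaMeasure ha hr
    have := fun n => (hμ n).prob
    simp
  | succ k ih =>
    rw [integral_pow_succ_gammaMeasure ha hr, hrec]
    have hexp : ∀ y : ℝ, Filter.Tendsto (fun n => exp (y * τ n)) Filter.atTop (nhds 1) := by
      intro y
      have := (Real.continuous_exp.tendsto _).comp (hlim.const_mul y)
      simpa [Function.comp_def] using this
    have hsq : ∀ y : ℝ, Filter.Tendsto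
        (fun n => exp (y * τ n) * (c + k * σ ^ 2 / 2) * ∫ x, x ^ k ∂μ n) Filter.atTop
        (nhds ((c + k * σ ^ 2 / 2) * ∫ x, x ^ k ∂gammaMeasure a r)) := by
      intro y
      have := ((hexp y).mul_const (c + k * σ ^ 2 / 2)).mul ih
      rwa [one_mul] at this
    refine tendsto_of_tendsto_of_tendsto_of_le_of_le (hsq (-(k * c + k ^ 2 * σ ^ 2 / 2)))
      (hsq ((k + 1) * c + (k + 1) ^ 2 * σ ^ 2 / 2)) (fun n => ?_) (fun n => ?_)
    · have := ((hμ n).integral_pow_succ_mem_Icc (hτ n) k).1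
      simpa only [neg_mul] using this
    · exact ((hμ n).integral_pow_succ_mem_Icc (hτ n) k).2

/-- If `X` solves `X = A (1 + X)` in law, then `(τ X)⁻¹` has an invariant law. -/
lemma isInvariantLaw_map_inv {s d τ : ℝ} {ν : Measure ℝ} (hτ : 0 < τ)
    (hprob : IsProbabilityMeasure ν) (hpos : ν (Set.Iio 0) = 0)
    (hfix : Measure.map (fun p : ℝ × ℝ => exp (s * p.1 - d) * (1 + p.2))
      ((gaussianReal 0 1).prod ν) = ν) :
    IsInvariantLaw s d τ (Measure.map (fun x => (τ * x)⁻¹) ν) := by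
  have hg : Measurable (fun x : ℝ => (τ * x)⁻¹) := by fun_prop
  have hnn : ∀ᵐ x ∂ν, 0 ≤ x := by
    rw [ae_iff]
    simp only [not_le]
    exact hpos
  have hnn2 : ∀ᵐ p ∂((gaussianReal 0 1).prod ν), 0 ≤ p.2 :=
    Measure.quasiMeasurePreserving_snd.ae hnn
  have hx : ∀ᵐ x ∂ν, 0 < x := by
    rw [← hfix, ae_map_iff (by fun_prop) measurableSet_Ioi]
    filter_upwards [hnn2] with p hp
    positivity
  have hx2 : ∀ᵐ p ∂((gaussianReal 0 1).prod ν), 0 < p.2 :=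
    Measure.quasiMeasurePreserving_snd.ae hx
  refine ⟨Measure.isProbabilityMeasure_map hg.aemeasurable, ?_, ?_⟩
  · rw [ae_map_iff hg.aemeasurable measurableSet_Ioi]
    filter_upwards [hx] with x hx
    positivity
  · have hprod : (gaussianReal 0 1).prod (Measure.map (fun x => (τ * x)⁻¹) ν) =
        Measure.map (Prod.map id fun x => (τ * x)⁻¹) ((gaussianReal 0 1).prod ν) := by
      rw [← Measure.map_prod_map _ _ measurable_id hg, Measure.map_id]
    rw [hprod, Measure.map_map (by fun_prop) (by fun_prop)]
    conv_rhs => rw [← hfix]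
    rw [Measure.map_map hg (by fun_prop)]
    refine Measure.map_congr ?_
    filter_upwards [hx2] with p hp
    simp only [Function.comp_apply, Prod.map_fst, Prod.map_snd, id_eq]
    have e : exp (d - s * p.1) = (exp (s * p.1 - d))⁻¹ := by rw [← Real.exp_neg, neg_sub]
    rw [e]
    have : exp (s * p.1 - d) ≠ 0 := (Real.exp_pos _).ne'
    field_simp
    ring

/-- If `m < σ²/2` and, for each time step `τ > 0`, `ν τ` is the stationary law of the
fixed-point equation `X∞ = A(1+X∞)` (a probability law on `[0,∞)`), then the
distributional limit `Y₀` of `Y_τ = τ X∞` as `τ → 0⁺` is such that `1/Y₀` satisfies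
the moment identity `E[(1/Y₀)^{θ+1}] = ((θ+1)σ²/2 - m) E[(1/Y₀)^θ]` for `θ` in a
neighborhood of `0`, and `1/Y₀ ~ Gamma(1 - 2m/σ², scale σ²/2)` (rate `2/σ²`), i.e.
`Y₀` follows an inverse Gamma distribution. -/
theorem stmt9 (σ m : ℝ) (hσ : 0 < σ) (hm : m < σ ^ 2 / 2)
    (ν : ℝ → Measure ℝ)
    (hprob : ∀ τ ∈ Set.Ioi (0 : ℝ), IsProbabilityMeasure (ν τ))
    (hpos : ∀ τ ∈ Set.Ioi (0 : ℝ), ν τ (Set.Iio 0) = 0)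
    (hfix : ∀ τ ∈ Set.Ioi (0 : ℝ),
      Measure.map
        (fun p : ℝ × ℝ =>
          Real.exp (σ * Real.sqrt τ * p.1 + (m - σ ^ 2 / 2) * τ) * (1 + p.2))
        ((gaussianReal 0 1).prod (ν τ)) = ν τ) :
    (∃ ε > 0, ∀ θ : ℝ, |θ| < ε →
      ∫ x, x ^ (θ + 1) ∂(gammaMeasure (1 - 2 * m / σ ^ 2) (2 / σ ^ 2))
        = ((θ + 1) * σ ^ 2 / 2 - m)
          * ∫ x, x ^ θ ∂(gammaMeasure (1 - 2 * m / σ ^ 2) (2 / σ ^ 2))) ∧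
    (∀ f : BoundedContinuousFunction ℝ ℝ,
      Filter.Tendsto
        (fun τ : ℝ => ∫ x, f ((τ * x)⁻¹) ∂(ν τ))
        (nhdsWithin 0 (Set.Ioi 0))
        (nhds (∫ x, f x ∂(gammaMeasure (1 - 2 * m / σ ^ 2) (2 / σ ^ 2))))) := by
  set a : ℝ := 1 - 2 * m / σ ^ 2 with ha_def
  set r : ℝ := 2 / σ ^ 2 with hr_def
  have hr : 0 < r := by positivity
  have ha : 0 < a := by
    rw [ha_def, sub_pos, div_lt_one (by positivity)]
    linarith
  have har : ∀ θ : ℝ, (a + θ) / r = (θ + 1) * σ ^ 2 / 2 - m := by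
    intro θ
    rw [ha_def, hr_def]
    field_simp
    ring
  refine ⟨⟨a, ha, fun θ hθ => ?_⟩, fun f => ?_⟩
  · rw [gammaMeasure_moment_succ ha hr (by linarith [(abs_lt.1 hθ).1]), har]
  · refine Filter.tendsto_of_seq_tendsto fun u hu => ?_
    rw [tendsto_nhdsWithin_iff] at hu
    obtain ⟨N, hN⟩ := Filter.eventually_atTop.1 hu.2
    refine (Filter.tendsto_add_atTop_iff_nat N).1 ?_
    have hτ : ∀ n, 0 < u (n + N) := fun n => hN _ (Nat.le_add_left _ _)
    have hinv : ∀ n, IsInvariantLaw (σ * √(u (n + N))) ((σ ^ 2 / 2 - m) * u (n + N)) (u (n + N))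
        (Measure.map (fun x => (u (n + N) * x)⁻¹) (ν (u (n + N)))) := by
      intro n
      refine isInvariantLaw_map_inv (hτ n) (hprob _ (hτ n)) (hpos _ (hτ n)) ?_
      have := hfix _ (hτ n)
      have e : ∀ y, y - (σ ^ 2 / 2 - m) * u (n + N) = y + (m - σ ^ 2 / 2) * u (n + N) := by
        intro y; ring
      simpa only [e] using this
    have hγ := isProbabilityMeasure_gammaMeasure ha hr
    have := fun n => (hinv n).prob
    have hlim := tendsto_integral_of_moments (fun n => (hinv n).pos)
      (fun n => (hinv n).integrable_pow (hτ n)) (ae_pos_gammaMeasure a r)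
      (integrable_pow_gammaMeasure ha hr)
      (tendsto_moment_of_isInvariantLaw ha hr (fun k => by rw [har]; ring) hτ
        ((Filter.tendsto_add_atTop_iff_nat N).2 hu.1) hinv)
      (half_pos hr) (fun h hh => tendsto_pow_div_factorial_mul_moment ha hr hh) f
    refine hlim.congr fun n => ?_
    exact integral_map (by fun_prop) f.continuous.aestronglyMeasurable
end

section
/- With β = σ²τ, ρ = mτ, p ∈ (0,1), the equation exp((β/2)κ(κ-1) + κρ)(1-p) = 1 has the unique positive solution μ = (−ρ + β/2 + √((ρ − β/2)² − 2β log(1−p)))/β, and μ > 0 for every m ∈ ℝ; moreover if ρ < β/2 then μ > 1 − 2ρ/β. -/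
open Real

/-- The exponential equation for `κ` is equivalent to a quadratic one, in completed-square form. -/
lemma exp_mul_eq_one_iff_sq {β ρ q : ℝ} (hβ : 0 < β) (hq : 0 < q) (κ : ℝ) :
    Real.exp (β / 2 * (κ * (κ - 1)) + κ * ρ) * q = 1 ↔
      (β * κ + (ρ - β / 2)) ^ 2 = (ρ - β / 2) ^ 2 - 2 * β * Real.log q := by
  have hexp : Real.exp (β / 2 * (κ * (κ - 1)) + κ * ρ) * q =
      Real.exp (β / 2 * (κ * (κ - 1)) + κ * ρ + Real.log q) := by
    rw [Real.exp_add _ (Real.log q), Real.exp_log hq]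
  rw [hexp, Real.exp_eq_one_iff]
  constructor
  · intro h
    linear_combination 2 * β * h
  · intro h
    apply mul_left_cancel₀ (mul_pos two_pos hβ).ne'
    linear_combination h

/-- With `β = σ²τ > 0`, `ρ = mτ`, `p ∈ (0,1)`, the equation
`exp((β/2)κ(κ-1) + κρ)(1-p) = 1` has the unique positive solution
`μ = (-ρ + β/2 + √((ρ-β/2)² - 2β log(1-p)))/β`; moreover `μ > 0`, and if
`ρ < β/2` then `μ > 1 - 2ρ/β`. -/
theorem stmt12 (β ρ p : ℝ) (hβ : 0 < β) (hp : p ∈ Set.Ioo (0 : ℝ) 1)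
    (μ : ℝ)
    (hμ : μ = (-ρ + β / 2
      + Real.sqrt ((ρ - β / 2) ^ 2 - 2 * β * Real.log (1 - p))) / β) :
    Real.exp (β / 2 * (μ * (μ - 1)) + μ * ρ) * (1 - p) = 1 ∧
    0 < μ ∧
    (∀ κ : ℝ, 0 < κ →
      Real.exp (β / 2 * (κ * (κ - 1)) + κ * ρ) * (1 - p) = 1 → κ = μ) ∧
    (ρ < β / 2 → 1 - 2 * ρ / β < μ) := by
  obtain ⟨hp0, hp1⟩ := hp
  have hq : 0 < 1 - p := by linarith
  have hlog : Real.log (1 - p) < 0 := Real.log_neg hq (by linarith)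
  have hD : (ρ - β / 2) ^ 2 < (ρ - β / 2) ^ 2 - 2 * β * Real.log (1 - p) := by
    nlinarith [mul_pos hβ (neg_pos.mpr hlog)]
  have hS := Real.sq_sqrt ((sq_nonneg _).trans hD.le)
  obtain ⟨hS₁, hS₂⟩ := abs_lt.mp (Real.lt_sqrt_of_sq_lt (by rwa [sq_abs]) :
    |ρ - β / 2| < √((ρ - β / 2) ^ 2 - 2 * β * Real.log (1 - p)))
  simp only [exp_mul_eq_one_iff_sq hβ hq]
  generalize (ρ - β / 2) ^ 2 - 2 * β * Real.log (1 - p) = D at *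
  have hβμ : β * μ = -ρ + β / 2 + √D := by
    rw [hμ]
    field_simp
  refine ⟨?_, ?_, fun κ hκ h => ?_, fun _ => ?_⟩
  · rw [hβμ]
    linear_combination hS
  · exact pos_of_mul_pos_right (by linarith : 0 < β * μ) hβ.le
  · have hfac : β * κ + ρ - β / 2 + √D ≠ 0 := by
      have := mul_pos hβ hκ
      linarith
    apply mul_left_cancel₀ hβ.ne'
    apply mul_left_cancel₀ hfac
    rw [hβμ]
    linear_combination h - hS
  · have hval : β * (1 - 2 * ρ / β) = β - 2 * ρ := by field_simp
    refine lt_of_mul_lt_mul_left ?_ hβ.le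
    linarith
end
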